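/- For every positive integer n, the sum of T(2n,d) over all depths d from 1 to n satisfies Σ_{d=1}^{n} T(2n,d) = (-1)^n E_{2n} π^{2n} / (4^n (2n)!), where E_{2n} is the 2n-th Euler number. -/

import Mathlib

open scoped BigOperators

/-- Multiple t-value `t(s₀, …, s_{d-1})`, summed over `n₀ > n₁ > ⋯ > n_{d-1} ≥ 1`
(encoded via `f i = n_i - 1`, so the odd number `2 n_i - 1` is `2 (f i) + 1`). -/
noncomputable def mtv (d : ℕ) (s : Fin d → ℕ) : ℝ :=
  ∑' f : {f : Fin d → ℕ // StrictAnti f}, ∏ i, 1 / (2 * (f.1 i : ℝ) + 1) ^ (s i)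

/-- `Tsum n d = T(2n, d)`: the sum of all multiple t-values of weight `2n` and
depth `d` with all arguments even. -/
noncomputable def Tsum (n d : ℕ) : ℝ :=
  ∑ j ∈ (Finset.Nat.antidiagonalTuple d n).filter (fun j => ∀ i, 1 ≤ j i),
    mtv d (fun i => 2 * j i)

/-- Euler numbers: `eulerE n = E_{2n}`, uniquely determined by `E_0 = 1` and the
recurrence `∑_{k=0}^{n} C(2n, 2k) E_{2k} = 0` for all `n ≥ 1`. -/
def eulerE : ℕ → ℤ
  | 0 => 1
  | n + 1 => -∑ k : Fin (n + 1), ((2 * (n + 1)).choose (2 * (k : ℕ)) : ℤ) * eulerE k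
  decreasing_by exact k.is_lt

open Filter Topology PowerSeries

/-- The reciprocal squares `1 / (2k + 1)^2` of the odd numbers. -/
noncomputable def oddRecipSq (k : ℕ) : ℝ := 1 / (2 * (k : ℝ) + 1) ^ 2

/-- The geometric series `x X + x² X² + ⋯` without its constant term. -/
noncomputable def geomTail (x : ℝ) : PowerSeries ℝ :=
  PowerSeries.mk fun j => if j = 0 then 0 else x ^ j

lemma oddRecipSq_nonneg (k : ℕ) : 0 ≤ oddRecipSq k := by
  unfold oddRecipSq; positivity

lemma oddRecipSq_le_one (k : ℕ) : oddRecipSq k ≤ 1 := by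
  unfold oddRecipSq
  rw [div_le_one (by positivity)]
  exact one_le_pow₀ (by linarith [(Nat.cast_nonneg k : (0 : ℝ) ≤ k)])

lemma summable_oddRecipSq : Summable oddRecipSq := by
  have h : Summable fun n : ℕ => 1 / (n : ℝ) ^ 2 :=
    Real.summable_one_div_nat_pow.mpr one_lt_two
  have := h.comp_injective (i := fun k : ℕ => 2 * k + 1) (fun a b hab => by simpa using hab)
  refine this.congr fun k => ?_
  simp [oddRecipSq]

lemma summable_prod_oddRecipSq :
    Summable fun s : Finset ℕ => ∏ k ∈ s, oddRecipSq k :=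
  summable_finsetProd_of_summable_nonneg oddRecipSq_nonneg summable_oddRecipSq

lemma one_sub_mul_one_add_geomTail (x : ℝ) :
    (1 + PowerSeries.C (-x) * X) * (1 + geomTail x) = 1 := by
  have h : 1 + geomTail x = PowerSeries.mk fun j => x ^ j := by
    ext j
    rcases eq_or_ne j 0 with rfl | hj <;> simp_all [geomTail, PowerSeries.coeff_one]
  rw [h]
  ext j
  rcases j with _ | j
  · simp
  · rw [add_mul, one_mul, mul_assoc, map_add, PowerSeries.coeff_C_mul,
      PowerSeries.coeff_succ_X_mul]
    simp [PowerSeries.coeff_one]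
    ring

lemma coeff_prod_geomTail_fin (d n : ℕ) (b : Fin d → ℝ) :
    coeff n (∏ i, geomTail (b i)) =
      ∑ j ∈ (Finset.Nat.antidiagonalTuple d n).filter (fun j => ∀ i, 1 ≤ j i),
        ∏ i, b i ^ j i := by
  classical
  rw [PowerSeries.coeff_prod, Finset.sum_filter]
  refine Finset.sum_bij' (fun l _ => ⇑l) (fun j _ => Finsupp.equivFunOnFinite.symm j)
    ?_ ?_ ?_ ?_ ?_
  · intro l hl
    simpa [Finset.Nat.mem_antidiagonalTuple, Finset.mem_finsuppAntidiag] using hl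
  · intro j hj
    simpa [Finset.Nat.mem_antidiagonalTuple, Finset.mem_finsuppAntidiag] using hj
  · intro l _
    ext; simp
  · intro j _
    ext; simp
  · intro l _
    split_ifs with h
    · refine Finset.prod_congr rfl fun i _ => ?_
      have := h i
      simp [geomTail, show l i ≠ 0 by omega]
    · push Not at h
      obtain ⟨i, hi⟩ := h
      exact Finset.prod_eq_zero (Finset.mem_univ i) (by simp [geomTail, show l i = 0 by omega])

lemma coeff_prod_geomTail_of_lt_card {ι : Type*} (b : ι → ℝ) (s : Finset ι) {n : ℕ}
    (h : n < s.card) : coeff n (∏ i ∈ s, geomTail (b i)) = 0 := by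
  refine PowerSeries.X_pow_dvd_iff.mp ?_ n h
  rw [← Finset.prod_const]
  refine Finset.prod_dvd_prod_of_dvd _ _ fun i _ => ?_
  rw [PowerSeries.X_dvd_iff]
  simp [geomTail]

lemma image_strictAnti_injective (d : ℕ) :
    Function.Injective
      fun f : {f : Fin d → ℕ // StrictAnti f} => (Finset.univ.image f.1 : Finset ℕ) := by
  rintro ⟨f, hf⟩ ⟨g, hg⟩ h
  have := congrArg (fun s : Finset ℕ => (s : Set ℕ)) h
  simp only [Finset.coe_image, Finset.coe_univ, Set.image_univ] at this
  exact Subtype.ext ((hf.range_inj hg).mp this)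

lemma exists_strictAnti_image_eq (s : Finset ℕ) :
    ∃ f : {f : Fin s.card → ℕ // StrictAnti f}, Finset.univ.image f.1 = s := by
  refine ⟨⟨s.orderEmbOfFin rfl ∘ Fin.rev, fun a b hab => ?_⟩, ?_⟩
  · exact (s.orderEmbOfFin rfl).strictMono (Fin.rev_lt_rev.mpr hab)
  · apply Finset.coe_injective
    rw [Finset.coe_image, Finset.coe_univ, Set.image_univ, Fin.rev_surjective.range_comp,
      Finset.range_orderEmbOfFin]

lemma hasSum_mtv {d : ℕ} {j : Fin d → ℕ} (hj : ∀ i, 1 ≤ j i) :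
    HasSum (fun f : {f : Fin d → ℕ // StrictAnti f} => ∏ i, oddRecipSq (f.1 i) ^ j i)
      (mtv d fun i => 2 * j i) := by
  have hs : Summable fun f : {f : Fin d → ℕ // StrictAnti f} =>
      ∏ i, oddRecipSq (f.1 i) ^ j i := by
    refine Summable.of_nonneg_of_le
      (fun f => Finset.prod_nonneg fun i _ => pow_nonneg (oddRecipSq_nonneg _) _) (fun f => ?_)
      (summable_prod_oddRecipSq.comp_injective (image_strictAnti_injective d))
    simp only [Function.comp]
    rw [Finset.prod_image fun a _ b _ h => f.2.injective h]
    refine Finset.prod_le_prod (fun i _ => pow_nonneg (oddRecipSq_nonneg _) _) fun i _ => ?_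
    exact pow_le_of_le_one (oddRecipSq_nonneg _) (oddRecipSq_le_one _)
      (Nat.one_le_iff_ne_zero.mp (hj i))
  convert! hs.hasSum using 1
  refine tsum_congr fun f => Finset.prod_congr rfl fun i _ => ?_
  rw [oddRecipSq, div_pow, one_pow, pow_mul]

lemma hasSum_Tsum (n d : ℕ) :
    HasSum (fun s : Finset ℕ => if s.card = d then
      coeff n (∏ k ∈ s, geomTail (oddRecipSq k)) else 0) (Tsum n d) := by
  rw [← (image_strictAnti_injective d).hasSum_iff]
  · have h : HasSum (fun f : {f : Fin d → ℕ // StrictAnti f} =>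
        ∑ j ∈ (Finset.Nat.antidiagonalTuple d n).filter (fun j => ∀ i, 1 ≤ j i),
          ∏ i, oddRecipSq (f.1 i) ^ j i) (Tsum n d) :=
      hasSum_sum fun j hj => hasSum_mtv (Finset.mem_filter.mp hj).2
    convert! h using 1
    ext f
    simp only [Function.comp]
    rw [if_pos (by rw [Finset.card_image_of_injective _ f.2.injective]; simp),
      Finset.prod_image fun a _ b _ h => f.2.injective h, coeff_prod_geomTail_fin]
  · intro s hs
    refine if_neg ?_
    rintro rfl
    exact hs (exists_strictAnti_image_eq s)

lemma hasSum_sum_Tsum {n : ℕ} (hn : 1 ≤ n) :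
    HasSum (fun s : Finset ℕ => coeff n (∏ k ∈ s, geomTail (oddRecipSq k)))
      (∑ d ∈ Finset.Icc 1 n, Tsum n d) := by
  convert! hasSum_sum (s := Finset.Icc 1 n) fun d _ => hasSum_Tsum n d using 1
  ext s
  rw [Finset.sum_ite_eq]
  split_ifs with h
  · rfl
  · rw [Finset.mem_Icc, not_and_or, not_le, not_le, Nat.lt_one_iff] at h
    rcases h with h | h
    · rw [Finset.card_eq_zero.mp h, Finset.prod_empty, PowerSeries.coeff_one,
        if_neg (by omega)]
    · exact coeff_prod_geomTail_of_lt_card _ _ h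

lemma HasSum.tendsto_sum_powerset_range {f : Finset ℕ → ℝ} {a : ℝ} (h : HasSum f a) :
    Tendsto (fun N => ∑ s ∈ (Finset.range N).powerset, f s) atTop (𝓝 a) :=
  h.comp (tendsto_finset_powerset_atTop_atTop.comp tendsto_finset_range)

lemma tendsto_coeff_prod_one_add_geomTail {n : ℕ} (hn : 1 ≤ n) :
    Tendsto (fun N => coeff n (∏ k ∈ Finset.range N, (1 + geomTail (oddRecipSq k)))) atTop
      (𝓝 (∑ d ∈ Finset.Icc 1 n, Tsum n d)) := by
  simpa [Finset.prod_one_add] using (hasSum_sum_Tsum hn).tendsto_sum_powerset_range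

/-- The signed elementary symmetric function of degree `m` in the `1 / (2k + 1)^2`. -/
noncomputable def signedEsymm (m : ℕ) : ℝ :=
  ∑' s : {s : Finset ℕ // s.card = m}, ∏ k ∈ s.1, -oddRecipSq k

lemma summable_prod_neg_oddRecipSq :
    Summable fun s : Finset ℕ => ∏ k ∈ s, -oddRecipSq k := by
  refine summable_finsetProd_of_summable_norm ?_
  simpa using summable_oddRecipSq.abs

lemma tendsto_coeff_prod_one_sub (m : ℕ) :
    Tendsto (fun N => coeff m (∏ k ∈ Finset.range N,
      (1 + PowerSeries.C (-oddRecipSq k) * X))) atTop (𝓝 (signedEsymm m)) := by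
  have h : HasSum (fun s : {s : Finset ℕ // s.card = m} => ∏ k ∈ s.1, -oddRecipSq k)
      (signedEsymm m) :=
    (summable_prod_neg_oddRecipSq.comp_injective Subtype.val_injective).hasSum
  replace h := (hasSum_subtype_iff_indicator (f := fun s : Finset ℕ => ∏ k ∈ s, -oddRecipSq k)
    (s := {s : Finset ℕ | s.card = m})).mp h
  refine h.tendsto_sum_powerset_range.congr fun N => ?_
  rw [Finset.prod_one_add, map_sum]
  refine Finset.sum_congr rfl fun s _ => ?_
  rw [Finset.prod_mul_distrib, Finset.prod_const, ← map_prod, PowerSeries.coeff_C_mul,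
    PowerSeries.coeff_X_pow, Set.indicator_apply]
  simp [eq_comm]

lemma hasSum_signedEsymm_mul_pow {z L : ℝ} (hL : Tendsto
    (fun N => ∏ k ∈ Finset.range N, (1 - oddRecipSq k * z)) atTop (𝓝 L)) :
    HasSum (fun m => signedEsymm m * z ^ m) L := by
  have hs : Summable fun s : Finset ℕ => ∏ k ∈ s, -(oddRecipSq k * z) := by
    refine summable_finsetProd_of_summable_norm ?_
    simpa using (summable_oddRecipSq.mul_right z).abs
  have hL' : HasSum (fun s : Finset ℕ => ∏ k ∈ s, -(oddRecipSq k * z)) L := by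
    have := hs.hasSum.tendsto_sum_powerset_range
    simp only [← Finset.prod_one_add, ← sub_eq_add_neg] at this
    rw [tendsto_nhds_unique hL this]
    exact hs.hasSum
  rw [← (Equiv.sigmaFiberEquiv (Finset.card (α := ℕ))).hasSum_iff] at hL'
  refine hL'.sigma fun m => ?_
  have h : HasSum (fun s : {s : Finset ℕ // s.card = m} => ∏ k ∈ s.1, -oddRecipSq k)
      (signedEsymm m) :=
    (summable_prod_neg_oddRecipSq.comp_injective Subtype.val_injective).hasSum
  convert! h.mul_right (z ^ m) using 1
  ext s
  simp only [Function.comp, Equiv.sigmaFiberEquiv, Equiv.coe_fn_mk, ← neg_mul]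
  rw [Finset.prod_mul_distrib, Finset.prod_const, s.2]

lemma tendsto_euler_cos_prod {x : ℝ} (h0 : 0 < x) (h1 : x < 1) :
    Tendsto (fun N => ∏ k ∈ Finset.range N, (1 - oddRecipSq k * x ^ 2)) atTop
      (𝓝 (Real.cos (Real.pi * x / 2))) := by
  have hsplit (N : ℕ) :
      ∏ j ∈ Finset.range (2 * N), (1 - x ^ 2 / ((j : ℝ) + 1) ^ 2) =
        (∏ k ∈ Finset.range N, (1 - oddRecipSq k * x ^ 2)) *
          ∏ j ∈ Finset.range N, (1 - (x / 2) ^ 2 / ((j : ℝ) + 1) ^ 2) := by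
    induction N with
    | zero => simp
    | succ N ih =>
      rw [mul_add, mul_one, Finset.prod_range_succ, Finset.prod_range_succ, ih,
        Finset.prod_range_succ, Finset.prod_range_succ]
      have h : 1 - x ^ 2 / (((2 * N + 1 : ℕ) : ℝ) + 1) ^ 2 =
          1 - (x / 2) ^ 2 / ((N : ℝ) + 1) ^ 2 := by
        push_cast
        field_simp
        ring
      rw [h, oddRecipSq]
      push_cast
      ring
  have hsin : Real.sin (Real.pi * (x / 2)) ≠ 0 :=
    (Real.sin_pos_of_pos_of_lt_pi (by positivity) (by nlinarith [Real.pi_pos])).ne'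
  have hA := (Real.tendsto_euler_sin_prod x).comp (tendsto_id.const_mul_atTop' two_pos)
  have hB := Real.tendsto_euler_sin_prod (x / 2)
  have hAB := (hA.div hB hsin).div_const 2
  have hval : Real.sin (Real.pi * x) / Real.sin (Real.pi * (x / 2)) / 2 =
      Real.cos (Real.pi * x / 2) := by
    rw [show Real.pi * x = 2 * (Real.pi * (x / 2)) by ring, Real.sin_two_mul,
      show 2 * (Real.pi * (x / 2)) / 2 = Real.pi * (x / 2) by ring]
    rw [mul_right_comm, mul_div_cancel_right₀ _ hsin, mul_div_cancel_left₀ _ two_ne_zero]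
  rw [hval] at hAB
  refine hAB.congr' ?_
  filter_upwards [hB.eventually_ne hsin] with N hN
  simp only [Function.comp, Pi.div_apply, id]
  rw [hsplit, div_div, div_eq_iff (mul_ne_zero hN two_ne_zero)]
  ring

/-- A real power series that sums to zero on the interval `(0, 1)` vanishes. -/
lemma eq_zero_of_hasSum_mul_pow {d : ℕ → ℝ}
    (h : ∀ z : ℝ, 0 < z → z < 1 → HasSum (fun m => d m * z ^ m) 0) : d = 0 := by
  set p := FormalMultilinearSeries.ofScalars ℝ d
  have hr : ((1 / 2 : NNReal) : ENNReal) ≤ p.radius := by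
    refine p.le_radius_of_summable_norm ?_
    refine (h (1 / 2) (by norm_num) (by norm_num)).summable.abs.congr fun m => ?_
    simp [p, abs_mul]
  have hp := (p.hasFPowerSeriesOnBall (lt_of_lt_of_le (by simp) hr)).hasFPowerSeriesAt
  have hz : ∃ᶠ z in 𝓝[≠] (0 : ℝ), p.sum z = 0 := by
    have : ∃ᶠ z in 𝓝[>] (0 : ℝ), p.sum z = 0 := by
      refine Eventually.frequently ?_
      filter_upwards [Ioo_mem_nhdsGT (zero_lt_one' ℝ)] with z hz
      rw [← (h z hz.1 hz.2).tsum_eq]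
      exact tsum_congr fun m => by simp [p, mul_comm]
    exact this.filter_mono (nhdsWithin_mono _ fun z hz => ne_of_gt hz)
  have := hp.eq_zero_of_eventually (hp.analyticAt.frequently_zero_iff_eventually_zero.mp hz)
  exact (FormalMultilinearSeries.ofScalars_series_eq_zero ℝ).mp this

lemma signedEsymm_eq (m : ℕ) :
    signedEsymm m = (-1) ^ m * (Real.pi / 2) ^ (2 * m) / (2 * m).factorial := by
  refine sub_eq_zero.mp (congrFun (eq_zero_of_hasSum_mul_pow (d := fun m =>
    signedEsymm m - (-1) ^ m * (Real.pi / 2) ^ (2 * m) / (2 * m).factorial) ?_) m)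
  intro z h0 h1
  have hx0 : 0 < √z := Real.sqrt_pos.mpr h0
  have hx1 : √z < 1 := by rw [Real.sqrt_lt' one_pos]; simpa using h1
  have hz : √z ^ 2 = z := Real.sq_sqrt h0.le
  have hE := tendsto_euler_cos_prod hx0 hx1
  rw [hz] at hE
  convert! (hasSum_signedEsymm_mul_pow hE).sub (Real.hasSum_cos (Real.pi * √z / 2)) using 1
  · ext m
    rw [show Real.pi * √z / 2 = Real.pi / 2 * √z by ring, mul_pow _ √z, pow_mul √z, hz]
    ring
  · simp

lemma sum_choose_mul_eulerE {n : ℕ} (hn : n ≠ 0) :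
    ∑ k ∈ Finset.range (n + 1), ((2 * n).choose (2 * k) : ℤ) * eulerE k = 0 := by
  obtain ⟨n, rfl⟩ := Nat.exists_eq_succ_of_ne_zero hn
  rw [Finset.sum_range_succ, Nat.succ_eq_add_one, eulerE,
    Fin.sum_univ_eq_sum_range
      (fun k => ((2 * (n + 1)).choose (2 * k) : ℤ) * eulerE k) (n + 1)]
  simp

lemma mk_signedEsymm_mul_mk_eulerE :
    PowerSeries.mk signedEsymm * PowerSeries.mk (fun n =>
      (-1) ^ n * (eulerE n : ℝ) * (Real.pi / 2) ^ (2 * n) / (2 * n).factorial) = 1 := by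
  ext n
  rw [mul_comm, PowerSeries.coeff_mul, PowerSeries.coeff_one]
  simp only [PowerSeries.coeff_mk]
  rw [Finset.Nat.sum_antidiagonal_eq_sum_range_succ (fun i j =>
    (-1) ^ i * (eulerE i : ℝ) * (Real.pi / 2) ^ (2 * i) / (2 * i).factorial * signedEsymm j)]
  split_ifs with hn
  · subst hn
    simp [signedEsymm_eq, eulerE]
  · have h := congrArg (fun t : ℤ => (t : ℝ)) (sum_choose_mul_eulerE hn)
    push_cast at h
    rw [← mul_zero ((-1) ^ n * (Real.pi / 2) ^ (2 * n) / ((2 * n).factorial : ℝ)), ← h,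
      Finset.mul_sum]
    refine Finset.sum_congr rfl fun k hk => ?_
    obtain ⟨l, rfl⟩ := Nat.exists_eq_add_of_le (Finset.mem_range_succ_iff.mp hk)
    rw [Nat.add_sub_cancel_left, signedEsymm_eq, mul_add 2 k l, Nat.cast_add_choose]
    field_simp
    ring

lemma mk_signedEsymm_mul_mk_sum_Tsum :
    PowerSeries.mk signedEsymm * PowerSeries.mk (fun n =>
      if n = 0 then 1 else ∑ d ∈ Finset.Icc 1 n, Tsum n d) = 1 := by
  ext n
  have hlim : Tendsto (fun N : ℕ => coeff n ((∏ k ∈ Finset.range N,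
      (1 + PowerSeries.C (-oddRecipSq k) * X)) *
        ∏ k ∈ Finset.range N, (1 + geomTail (oddRecipSq k)))) atTop
      (𝓝 (coeff n (PowerSeries.mk signedEsymm * PowerSeries.mk (fun n =>
        if n = 0 then 1 else ∑ d ∈ Finset.Icc 1 n, Tsum n d)))) := by
    simp only [PowerSeries.coeff_mul, PowerSeries.coeff_mk]
    refine tendsto_finsetSum _ fun ij _ => (tendsto_coeff_prod_one_sub ij.1).mul ?_
    split_ifs with h
    · rw [h]
      simp [geomTail]
    · exact tendsto_coeff_prod_one_add_geomTail (Nat.one_le_iff_ne_zero.mpr h)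
  refine tendsto_nhds_unique hlim ?_
  simp only [← Finset.prod_mul_distrib, one_sub_mul_one_add_geomTail, Finset.prod_const_one,
    tendsto_const_nhds_iff]

/-- The sum of `T(2n, d)` over all depths `1 ≤ d ≤ n` equals
`(-1)^n E_{2n} π^{2n} / (4^n (2n)!)` (equation (6) of the paper). -/
theorem sum_T2n_d_eq_euler (n : ℕ) (hn : 1 ≤ n) :
    ∑ d ∈ Finset.Icc 1 n, Tsum n d
      = (-1) ^ n * (eulerE n : ℝ) * Real.pi ^ (2 * n) / (4 ^ n * (2 * n).factorial) := by
  have h : PowerSeries.mk (fun n => if n = 0 then 1 else ∑ d ∈ Finset.Icc 1 n, Tsum n d) =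
      PowerSeries.mk (fun n =>
        (-1) ^ n * (eulerE n : ℝ) * (Real.pi / 2) ^ (2 * n) / (2 * n).factorial) :=
    left_inv_eq_right_inv ((mul_comm _ _).trans mk_signedEsymm_mul_mk_sum_Tsum)
      mk_signedEsymm_mul_mk_eulerE
  have hcoeff := congrArg (coeff n) h
  rw [PowerSeries.coeff_mk, PowerSeries.coeff_mk, if_neg (by omega)] at hcoeff
  rw [hcoeff, div_pow, pow_mul 2 2 n]
  norm_num
  field_simp
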